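/- Let ξ ∈ {0,1}^{A[S,T]} be an optimal flow for the M♮-convex submodular flow formulation (MSF) of the shortest S-T bibranching problem. Then there exists an optimal potential (p,q) ∈ Z^S × Z^T such that for every arc a = uv ∈ A[S,T] with ξ(a) = 1, w(a) + p(u) − q(v) = 0 (not merely ≤ 0). -/

import Mathlib

open scoped Classical
open Finset

variable {V : Type*} [Fintype V] [DecidableEq V]

/-- A closed directed walk (cycle) using arcs of `B`. -/
def HasCycle (B : Finset (V × V)) : Prop :=
  ∃ (n : ℕ) (f : Fin (n + 1) → V), ∀ i : Fin (n + 1), (f i, f (i + 1)) ∈ B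

/-- `B` is a branching in the digraph with arc set `A`. -/
def IsBranching (A B : Finset (V × V)) : Prop :=
  B ⊆ A ∧ (∀ v : V, (B.filter (fun a => a.2 = v)).card ≤ 1) ∧ ¬ HasCycle B

/-- `R(B)`: the set of vertices with no arc of `B` entering them. -/
def rootSet (B : Finset (V × V)) : Finset V :=
  Finset.univ.filter (fun v => ∀ a ∈ B, a.2 ≠ v)

/-- Reachability via directed paths using arcs of `A`. -/
def Reaches (A : Finset (V × V)) (u v : V) : Prop :=
  Relation.ReflTransGen (fun x y => (x, y) ∈ A) u v

/-- A source component: a strongly connected component with no entering arc. -/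
def IsSourceComponent (A : Finset (V × V)) (K : Set V) : Prop :=
  (∃ v : V, K = {u : V | Reaches A u v ∧ Reaches A v u}) ∧
    ∀ a ∈ A, a.2 ∈ K → a.1 ∈ K


/-- Characteristic vector of a single vertex. -/
def chi (u : V) : V → ℤ := fun v => if v = u then 1 else 0

/-- `gFun A w η`: the minimum weight of a branching `B` in `(V, A)` with
`R(B) = supp⁺(η)`, for `η ∈ ℤ₊^V`; `+∞` (i.e. `⊤`) otherwise. -/
noncomputable def gFun (A : Finset (V × V)) (w : V × V → ℤ) (η : V → ℤ) : WithTop ℤ :=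
  if ∀ v : V, 0 ≤ η v then
    (A.powerset.filter (fun B => IsBranching A B ∧
        rootSet B = Finset.univ.filter (fun v => 0 < η v))).inf
      (fun B => ((∑ a ∈ B, w a : ℤ) : WithTop ℤ))
  else ⊤

/-- Arcs of `B` with both ends in `X`. -/
def arcsIn (X : Finset V) (B : Finset (V × V)) : Finset (V × V) :=
  B.filter (fun a => a.1 ∈ X ∧ a.2 ∈ X)

/-- Arcs of `B` from `S` to `T`. -/
def arcsST (S T : Finset V) (B : Finset (V × V)) : Finset (V × V) :=
  B.filter (fun a => a.1 ∈ S ∧ a.2 ∈ T)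

/-- A cobranching: an arc set whose reversal is a branching. -/
def IsCobranching (A B : Finset (V × V)) : Prop :=
  IsBranching (A.image Prod.swap) (B.image Prod.swap)

/-- `g_T(η)`: minimum weight of a branching `B_T` of `D[T]` with
`R(B_T) = supp⁺(η)`; `⊤` if `η ∉ ℤ₊^T` or no such branching exists. -/
noncomputable def gT (T : Finset V) (A : Finset (V × V)) (w : V × V → ℤ) (η : V → ℤ) :
    WithTop ℤ :=
  if ∀ v ∈ T, 0 ≤ η v then
    ((arcsIn T A).powerset.filter (fun B => IsBranching (arcsIn T A) B ∧
        T.filter (fun v => ∀ a ∈ B, a.2 ≠ v) = T.filter (fun v => 0 < η v))).inf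
      (fun B => ((∑ a ∈ B, w a : ℤ) : WithTop ℤ))
  else ⊤

/-- `g_S(η)`: minimum weight of a cobranching `B_S` of `D[S]` with
`R*(B_S) = supp⁺(η)`; `⊤` if `η ∉ ℤ₊^S` or no such cobranching exists. -/
noncomputable def gS (S : Finset V) (A : Finset (V × V)) (w : V × V → ℤ) (η : V → ℤ) :
    WithTop ℤ :=
  if ∀ u ∈ S, 0 ≤ η u then
    ((arcsIn S A).powerset.filter (fun B => IsCobranching (arcsIn S A) B ∧
        S.filter (fun u => ∀ a ∈ B, a.1 ≠ u) = S.filter (fun u => 0 < η u))).inf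
      (fun B => ((∑ a ∈ B, w a : ℤ) : WithTop ℤ))
  else ⊤

/-- `∂ξ|_S`: out-degree vector of a flow (arc set) `F ⊆ A[S,T]`. -/
def outd (F : Finset (V × V)) : V → ℤ := fun u => ((F.filter (fun a => a.1 = u)).card : ℤ)

/-- `−∂ξ|_T`: in-degree vector of a flow (arc set) `F ⊆ A[S,T]`. -/
def ind (F : Finset (V × V)) : V → ℤ := fun v => ((F.filter (fun a => a.2 = v)).card : ℤ)

/-- The objective of the M♮-convex submodular flow formulation (MSF):
`w·ξ + g_S(∂ξ|_S) + g_T(−∂ξ|_T)`. -/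
noncomputable def msfObj (S T : Finset V) (A : Finset (V × V)) (w : V × V → ℤ)
    (F : Finset (V × V)) : WithTop ℤ :=
  ((∑ a ∈ F, w a : ℤ) : WithTop ℤ) + gS S A w (outd F) + gT T A w (ind F)

/-- The arc `a` enters the vertex set `U`. -/
def Enters (U : Finset V) (a : V × V) : Prop := a.2 ∈ U ∧ a.1 ∉ U

/-- The number of members of the family `𝒴` entered by the arc `a`. -/
noncomputable def cutLoad (𝒴 : Multiset (Finset V)) (a : V × V) : ℕ :=
  𝒴.countP fun U => Enters U a

/-- The number of members of the family `𝒴` containing the vertex `v`. -/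
noncomputable def depth (𝒴 : Multiset (Finset V)) (v : V) : ℕ :=
  𝒴.countP fun U => v ∈ U

/-- A family of nonempty subsets of `X` whose cuts are packed into the weights `w` on `E`. -/
def IsPacking (X : Finset V) (E : Finset (V × V)) (w : V × V → ℤ)
    (𝒴 : Multiset (Finset V)) : Prop :=
  (∀ U ∈ 𝒴, U ⊆ X ∧ U.Nonempty) ∧ ∀ a ∈ E, (cutLoad 𝒴 a : ℤ) ≤ w a

/-- A strictly increasing and strictly concave function of the cardinality, summed over `𝒴`. -/
def familyCost (𝒴 : Multiset (Finset V)) : ℕ :=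
  (𝒴.map fun U => U.card * (2 * Fintype.card V - U.card)).sum

/-- Any two members are nested or disjoint. -/
def IsLaminar (𝒴 : Multiset (Finset V)) : Prop :=
  ∀ U ∈ 𝒴, ∀ W ∈ 𝒴, U ⊆ W ∨ W ⊆ U ∨ Disjoint U W

/-- The family has least cost among the packings of the same size and no larger depths. -/
def IsCostMinimal (X : Finset V) (E : Finset (V × V)) (w : V × V → ℤ)
    (𝒴 : Multiset (Finset V)) : Prop :=
  ∀ 𝒴', IsPacking X E w 𝒴' → 𝒴'.card = 𝒴.card → (∀ v, depth 𝒴' v ≤ depth 𝒴 v) →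
    familyCost 𝒴 ≤ familyCost 𝒴'

/-- A nonempty set compatible with `𝒴` which no tight arc enters. -/
def IsTightClosed (X : Finset V) (E : Finset (V × V)) (w : V × V → ℤ)
    (𝒴 : Multiset (Finset V)) (K : Finset V) : Prop :=
  K ⊆ X ∧ K.Nonempty ∧ (∀ U ∈ 𝒴, U ⊆ K ∨ Disjoint U K) ∧
    ∀ a ∈ E, (cutLoad 𝒴 a : ℤ) = w a → a.2 ∈ K → a.1 ∈ K

/-- An inclusionwise minimal `IsTightClosed` set. -/
def IsMinTightClosed (X : Finset V) (E : Finset (V × V)) (w : V × V → ℤ)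
    (𝒴 : Multiset (Finset V)) (K : Finset V) : Prop :=
  IsTightClosed X E w 𝒴 K ∧ ∀ K' ⊆ K, IsTightClosed X E w 𝒴 K' → K' = K

theorem sum_countP_eq {ι α : Type*} (s : Finset ι) (𝒴 : Multiset α) (r : ι → α → Prop)
    [∀ i, DecidablePred (r i)] [∀ U, DecidablePred fun i => r i U] :
    ∑ i ∈ s, 𝒴.countP (r i) = (𝒴.map fun U => (s.filter fun i => r i U).card).sum := by
  induction 𝒴 using Multiset.induction with
  | empty => simp
  | cons U 𝒴 ih =>
    simp only [Multiset.countP_cons, Multiset.map_cons, Multiset.sum_cons, sum_add_distrib, ih,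
      card_filter]
    rw [add_comm]

theorem cutLoad_cons (U : Finset V) (𝒴 : Multiset (Finset V)) (a : V × V) :
    cutLoad (U ::ₘ 𝒴) a = cutLoad 𝒴 a + if a.2 ∈ U ∧ a.1 ∉ U then 1 else 0 := by
  rw [cutLoad, Multiset.countP_cons, cutLoad]
  congr

theorem depth_cons (U : Finset V) (𝒴 : Multiset (Finset V)) (v : V) :
    depth (U ::ₘ 𝒴) v = depth 𝒴 v + if v ∈ U then 1 else 0 :=
  Multiset.countP_cons ..

theorem sum_cutLoad (B : Finset (V × V)) (𝒴 : Multiset (Finset V)) :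
    ∑ a ∈ B, cutLoad 𝒴 a = (𝒴.map fun U => (B.filter (Enters U)).card).sum :=
  sum_countP_eq B 𝒴 fun a U => Enters U a

theorem sum_depth {ι : Type*} (F : Finset ι) (g : ι → V) (𝒴 : Multiset (Finset V)) :
    ∑ i ∈ F, depth 𝒴 (g i) = (𝒴.map fun U => (F.filter fun i => g i ∈ U).card).sum :=
  sum_countP_eq F 𝒴 fun i U => g i ∈ U

theorem Multiset.sum_map_le_card {α : Type*} (𝒴 : Multiset α) (f : α → ℕ)
    (h : ∀ U ∈ 𝒴, f U ≤ 1) : (𝒴.map f).sum ≤ 𝒴.card := by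
  have := Multiset.sum_le_card_nsmul (𝒴.map f) 1 (by simpa using h)
  simpa using this

theorem Multiset.card_le_sum_map {α : Type*} (𝒴 : Multiset α) (f : α → ℕ)
    (h : ∀ U ∈ 𝒴, 1 ≤ f U) : 𝒴.card ≤ (𝒴.map f).sum := by
  have := Multiset.card_nsmul_le_sum (s := 𝒴.map f) (a := 1) (by simpa using h)
  simpa using this

theorem IsCostMinimal.isLaminar {X : Finset V} {E : Finset (V × V)} {w : V × V → ℤ}
    {𝒴 : Multiset (Finset V)} (hmin : IsCostMinimal X E w 𝒴) (hp : IsPacking X E w 𝒴) :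
    IsLaminar 𝒴 := by
  intro U hU W hW
  by_contra! hcon
  obtain ⟨hUW, hWU, hd⟩ := hcon
  obtain ⟨𝒲, rfl⟩ := Multiset.exists_cons_of_mem hU
  have hne : W ≠ U := by rintro rfl; exact hUW subset_rfl
  obtain ⟨𝒲, rfl⟩ := Multiset.exists_cons_of_mem ((Multiset.mem_cons.1 hW).resolve_left hne)
  have hX : U ⊆ X ∧ U.Nonempty := hp.1 U (by simp)
  have hX' : W ⊆ X ∧ W.Nonempty := hp.1 W (by simp)
  have key := hmin ((U ∩ W) ::ₘ (U ∪ W) ::ₘ 𝒲) ⟨?_, ?_⟩ (by simp) ?_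
  · simp only [familyCost, Multiset.map_cons, Multiset.sum_cons] at key
    have h1 := card_union_add_card_inter U W
    have h2 : (U ∩ W).card < U.card := card_lt_card (by
      rw [Finset.ssubset_iff_subset_ne]
      exact ⟨inter_subset_left, fun h => hUW (inter_eq_left.1 h)⟩)
    have h3 : (U ∩ W).card < W.card := card_lt_card (by
      rw [Finset.ssubset_iff_subset_ne]
      exact ⟨inter_subset_right, fun h => hWU (inter_eq_right.1 h)⟩)
    have h4 := card_le_univ (U ∪ W)
    generalize (U ∩ W).card = i at *
    generalize (U ∪ W).card = j at *
    generalize Fintype.card V = n at *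
    obtain ⟨x, hx⟩ := Nat.exists_eq_add_of_lt h2
    obtain ⟨y, hy⟩ := Nat.exists_eq_add_of_lt h3
    obtain ⟨d, rfl⟩ := Nat.exists_eq_add_of_le h4
    rw [hx, hy] at key
    obtain rfl : j = i + x + y + 2 := by omega
    rw [show 2 * (i + x + y + 2 + d) - i = i + 2 * x + 2 * y + 4 + 2 * d by omega,
      show 2 * (i + x + y + 2 + d) - (i + x + y + 2) = i + x + y + 2 + 2 * d by omega,
      show 2 * (i + x + y + 2 + d) - (i + x + 1) = i + x + 2 * y + 3 + 2 * d by omega,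
      show 2 * (i + x + y + 2 + d) - (i + y + 1) = i + y + 2 * x + 3 + 2 * d by omega] at key
    nlinarith [Nat.zero_le (x * y)]
  · intro Z hZ
    simp only [Multiset.mem_cons] at hZ
    rcases hZ with rfl | rfl | hZ
    · exact ⟨inter_subset_left.trans hX.1, not_disjoint_iff_nonempty_inter.1 hd⟩
    · exact ⟨union_subset hX.1 hX'.1, hX.2.mono subset_union_left⟩
    · exact hp.1 Z (by simp [hZ])
  · intro a ha
    refine le_trans ?_ (hp.2 a ha)
    simp only [cutLoad_cons, mem_inter, mem_union]
    norm_cast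
    by_cases h1 : a.1 ∈ U <;> by_cases h2 : a.2 ∈ U <;> by_cases h3 : a.1 ∈ W <;>
      by_cases h4 : a.2 ∈ W <;> simp [h1, h2, h3, h4]
  · intro v
    simp only [depth_cons, mem_inter, mem_union]
    by_cases h1 : v ∈ U <;> by_cases h2 : v ∈ W <;> simp [h1, h2]

theorem IsCostMinimal.exists_tight_arc {X : Finset V} {E : Finset (V × V)} {w : V × V → ℤ}
    {𝒴 : Multiset (Finset V)} (hmin : IsCostMinimal X E w 𝒴) (hp : IsPacking X E w 𝒴)
    {U K : Finset V} (hU : U ∈ 𝒴) (hKU : K ⊂ U) (hK : K.Nonempty) :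
    ∃ a ∈ E, (cutLoad 𝒴 a : ℤ) = w a ∧ a.1 ∈ U ∧ a.1 ∉ K ∧ a.2 ∈ K := by
  by_contra! hcon
  obtain ⟨𝒲, rfl⟩ := Multiset.exists_cons_of_mem hU
  have hX : U ⊆ X ∧ U.Nonempty := hp.1 U (by simp)
  have key := hmin (K ::ₘ 𝒲) ⟨?_, ?_⟩ (by simp) ?_
  · simp only [familyCost, Multiset.map_cons, Multiset.sum_cons] at key
    have h1 := card_lt_card hKU
    have h4 := card_le_univ U
    obtain ⟨x, hx⟩ := Nat.exists_eq_add_of_lt h1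
    obtain ⟨d, hd⟩ := Nat.exists_eq_add_of_le h4
    rw [hd, hx] at key
    generalize K.card = i at *
    rw [show 2 * (i + x + 1 + d) - i = i + 2 * x + 2 + 2 * d by omega,
      show 2 * (i + x + 1 + d) - (i + x + 1) = i + x + 1 + 2 * d by omega] at key
    nlinarith [Nat.zero_le (x * x), Nat.zero_le (x * d)]
  · intro Z hZ
    simp only [Multiset.mem_cons] at hZ
    rcases hZ with rfl | hZ
    · exact ⟨hKU.1.trans hX.1, hK⟩
    · exact hp.1 Z (by simp [hZ])
  · intro a ha
    have h := hp.2 a ha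
    have hc := hcon a ha
    have hs := @hKU.1 a.2
    have hs' := @hKU.1 a.1
    simp only [cutLoad_cons] at h hc ⊢
    by_cases h1 : a.1 ∈ U <;> by_cases h2 : a.2 ∈ U <;> by_cases h3 : a.1 ∈ K <;>
      by_cases h4 : a.2 ∈ K <;> simp_all <;> omega
  · intro v
    have hs := @hKU.1 v
    simp only [depth_cons]
    by_cases h1 : v ∈ U <;> by_cases h2 : v ∈ K <;> simp_all

theorem IsTightClosed.exists_min {X : Finset V} {E : Finset (V × V)} {w : V × V → ℤ}
    {𝒴 : Multiset (Finset V)} {K : Finset V} (hK : IsTightClosed X E w 𝒴 K) :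
    ∃ K' ⊆ K, IsMinTightClosed X E w 𝒴 K' := by
  obtain ⟨K', hK', hmin⟩ := exists_min_image
    (K.powerset.filter (IsTightClosed X E w 𝒴)) Finset.card ⟨K, by simp [hK]⟩
  simp only [mem_filter, mem_powerset] at hK' hmin
  exact ⟨K', hK'.1, hK'.2, fun K'' h h' => eq_of_subset_of_card_le h
    (hmin K'' ⟨h.trans hK'.1, h'⟩)⟩

theorem IsMinTightClosed.eq_of_mem {X : Finset V} {E : Finset (V × V)} {w : V × V → ℤ}
    {𝒴 : Multiset (Finset V)} {K K' : Finset V} (hK : IsMinTightClosed X E w 𝒴 K)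
    (hK' : IsMinTightClosed X E w 𝒴 K') {v : V} (hv : v ∈ K) (hv' : v ∈ K') : K = K' := by
  have h : IsTightClosed X E w 𝒴 (K ∩ K') := by
    refine ⟨inter_subset_left.trans hK.1.1, ⟨v, by simp [hv, hv']⟩, fun U hU => ?_,
      fun a ha ht h => ?_⟩
    · rcases hK.1.2.2.1 U hU with h1 | h1
      · rcases hK'.1.2.2.1 U hU with h2 | h2
        · exact .inl (subset_inter h1 h2)
        · exact .inr (h2.mono_right inter_subset_right)
      · exact .inr (h1.mono_right inter_subset_left)
    · rw [mem_inter] at h ⊢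
      exact ⟨hK.1.2.2.2 a ha ht h.1, hK'.1.2.2.2 a ha ht h.2⟩
  rw [← hK.2 _ inter_subset_left h, ← hK'.2 _ inter_subset_right h]
  simp

theorem IsMinTightClosed.subset_of_mem {X : Finset V} {E : Finset (V × V)} {w : V × V → ℤ}
    {𝒴 : Multiset (Finset V)} {K U : Finset V} (hK : IsMinTightClosed X E w 𝒴 K)
    (hU : U ∈ 𝒴) {v : V} (hv : v ∈ K) (hvU : v ∈ U) : U ⊆ K :=
  (hK.1.2.2.1 U hU).resolve_right fun h => disjoint_left.1 h hvU hv

theorem exists_extending_arc {X : Finset V} {E : Finset (V × V)} {w : V × V → ℤ}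
    {𝒴 : Multiset (Finset V)} (hE : ∀ a ∈ E, a.1 ∈ X ∧ a.2 ∈ X)
    (hmin : IsCostMinimal X E w 𝒴) (hp : IsPacking X E w 𝒴) {R Y : Finset V}
    (hR : ∀ K, IsTightClosed X E w 𝒴 K → ∃ r ∈ R, r ∈ K) (hRY : R ⊆ Y) (hY : Y ⊂ X) :
    ∃ a ∈ E, (cutLoad 𝒴 a : ℤ) = w a ∧ a.1 ∈ Y ∧ a.2 ∉ Y ∧
      ∀ U ∈ 𝒴, Enters U a → Disjoint U Y := by
  by_cases hex : ∃ U ∈ 𝒴, ¬ Disjoint U Y ∧ ¬ U ⊆ Y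
  · obtain ⟨U₀, hU₀, hU₀'⟩ := hex
    obtain ⟨U, hU, hUmin⟩ := exists_min_image
      (𝒴.toFinset.filter fun U => ¬ Disjoint U Y ∧ ¬ U ⊆ Y) Finset.card
      ⟨U₀, by simp [hU₀, hU₀']⟩
    simp only [mem_filter, Multiset.mem_toFinset] at hU hUmin
    obtain ⟨hU, hUd, hUY⟩ := hU
    obtain ⟨a, haE, hat, ha1, ha1', ha2⟩ := hmin.exists_tight_arc hp hU (K := U \ Y)
      (sdiff_subset.ssubset_of_ne fun h => hUd (sdiff_eq_self_iff_disjoint.1 h))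
      (sdiff_nonempty.2 hUY)
    rw [mem_sdiff] at ha1' ha2
    refine ⟨a, haE, hat, by tauto, ha2.2, fun W hW hWa => ?_⟩
    by_contra hWd
    have hWU : W ⊂ U := by
      rcases hmin.isLaminar hp W hW U hU with h | h | h
      · exact ⟨h, fun h' => hWa.2 (h' ha1)⟩
      · exact absurd (h ha1) hWa.2
      · exact absurd ha2.1 (disjoint_left.1 h hWa.1)
    exact absurd (hUmin W ⟨hW, hWd, fun h => ha2.2 (h hWa.1)⟩)
      (not_le.2 (card_lt_card hWU))
  · push Not at hex
    by_contra! hcon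
    have hclosed : IsTightClosed X E w 𝒴 (X \ Y) := by
      refine ⟨sdiff_subset, sdiff_nonempty.2 hY.2, fun U hU => ?_, fun a ha hat ha2 => ?_⟩
      · by_cases h : Disjoint U Y
        · exact .inl (subset_sdiff.2 ⟨(hp.1 U hU).1, h⟩)
        · exact .inr (disjoint_sdiff.mono_left (hex U hU h))
      · rw [mem_sdiff] at ha2 ⊢
        refine ⟨(hE a ha).1, fun ha1 => ?_⟩
        obtain ⟨U, hU, hUa, hUd⟩ := hcon a ha hat ha1 ha2.2
        exact ha2.2 (hex U hU hUd hUa.1)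
    obtain ⟨r, hr, hr'⟩ := hR _ hclosed
    exact (mem_sdiff.1 hr').2 (hRY hr)

theorem not_hasCycle_insert {B : Finset (V × V)} {u v : V} (hB : ¬ HasCycle B) (huv : u ≠ v)
    (hv : ∀ a ∈ B, a.1 ≠ v) : ¬ HasCycle (insert (u, v) B) := by
  rintro ⟨n, f, hf⟩
  have hne : ∀ i, f i ≠ v := by
    intro i hi
    rcases mem_insert.1 (hf i) with h | h
    · exact huv ((congrArg Prod.fst h).symm.trans hi)
    · exact hv _ h hi
  refine hB ⟨n, f, fun i => (mem_insert.1 (hf i)).resolve_left fun h => ?_⟩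
  exact hne _ (congrArg Prod.snd h)

/-- A branching with root set `R`, grown inside `Y` along tight arcs and entering every
member of `𝒴` at most once. -/
structure IsPartialBranching (E : Finset (V × V)) (w : V × V → ℤ) (𝒴 : Multiset (Finset V))
    (R Y : Finset V) (B : Finset (V × V)) : Prop where
  roots_subset : R ⊆ Y
  subset : B ⊆ E
  ends : ∀ a ∈ B, a.1 ∈ Y ∧ a.2 ∈ Y
  head_notMem : ∀ a ∈ B, a.2 ∉ R
  exists_arc : ∀ v ∈ Y, v ∉ R → ∃ a ∈ B, a.2 = v
  unique : ∀ a ∈ B, ∀ b ∈ B, a.2 = b.2 → a = b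
  acyclic : ¬ HasCycle B
  tight : ∀ a ∈ B, (cutLoad 𝒴 a : ℤ) = w a
  once : ∀ U ∈ 𝒴, (R ∩ U).card + (B.filter (Enters U)).card ≤ 1

theorem IsPartialBranching.insert {E : Finset (V × V)} {w : V × V → ℤ}
    {𝒴 : Multiset (Finset V)} {R Y : Finset V} {B : Finset (V × V)}
    (h : IsPartialBranching E w 𝒴 R Y B) {a : V × V} (haE : a ∈ E)
    (hat : (cutLoad 𝒴 a : ℤ) = w a) (ha1 : a.1 ∈ Y) (ha2 : a.2 ∉ Y)
    (hU : ∀ U ∈ 𝒴, Enters U a → Disjoint U Y) :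
    IsPartialBranching E w 𝒴 R (insert a.2 Y) (insert a B) where
  roots_subset := h.roots_subset.trans (subset_insert _ _)
  subset := insert_subset haE h.subset
  ends b hb := by
    rcases mem_insert.1 hb with rfl | hb
    · simp [ha1]
    · simp [h.ends b hb]
  head_notMem b hb := by
    rcases mem_insert.1 hb with rfl | hb
    · exact fun hR => ha2 (h.roots_subset hR)
    · exact h.head_notMem b hb
  exists_arc v hv hvR := by
    rcases mem_insert.1 hv with rfl | hv
    · exact ⟨a, by simp, rfl⟩
    · obtain ⟨b, hb, hb'⟩ := h.exists_arc v hv hvR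
      exact ⟨b, by simp [hb], hb'⟩
  unique b hb c hc hbc := by
    rcases mem_insert.1 hb with rfl | hb' <;> rcases mem_insert.1 hc with rfl | hc'
    · rfl
    · exact absurd (hbc ▸ (h.ends c hc').2) ha2
    · exact absurd (hbc ▸ (h.ends b hb').2) ha2
    · exact h.unique b hb' c hc' hbc
  acyclic := not_hasCycle_insert h.acyclic (fun h' => ha2 (h' ▸ ha1))
    fun b hb h' => ha2 (h' ▸ (h.ends b hb).1)
  tight b hb := by
    rcases mem_insert.1 hb with rfl | hb
    · exact hat
    · exact h.tight b hb
  once U hUmem := by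
    by_cases hUa : Enters U a
    · have hd := hU U hUmem hUa
      have h1 : R ∩ U = ∅ := by
        rw [← disjoint_iff_inter_eq_empty]
        exact (hd.mono_right h.roots_subset).symm
      have h2 : B.filter (Enters U) = ∅ := by
        rw [filter_eq_empty_iff]
        exact fun b hb hb' => disjoint_left.1 hd hb'.1 (h.ends b hb).2
      rw [filter_insert, if_pos hUa, h1, h2]
      simp
    · rw [filter_insert, if_neg hUa]
      exact h.once U hUmem

theorem IsPartialBranching.exists_spanning {X : Finset V} {E : Finset (V × V)} {w : V × V → ℤ}
    {𝒴 : Multiset (Finset V)} (hE : ∀ a ∈ E, a.1 ∈ X ∧ a.2 ∈ X)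
    (hmin : IsCostMinimal X E w 𝒴) (hp : IsPacking X E w 𝒴) {R : Finset V}
    (hR : ∀ K, IsTightClosed X E w 𝒴 K → ∃ r ∈ R, r ∈ K) {Y : Finset V} {B : Finset (V × V)}
    (h : IsPartialBranching E w 𝒴 R Y B) (hY : Y ⊆ X) :
    ∃ B, IsPartialBranching E w 𝒴 R X B := by
  by_cases hYX : Y = X
  · exact ⟨B, hYX ▸ h⟩
  · obtain ⟨a, haE, hat, ha1, ha2, hU⟩ := exists_extending_arc hE hmin hp hR h.roots_subset
      (hY.ssubset_of_ne hYX)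
    have := card_lt_card (ssubset_insert (a := a.2) ha2)
    have hY' : Insert.insert a.2 Y ⊆ X := insert_subset (hE a haE).2 hY
    have hlt : X.card - (Insert.insert a.2 Y).card < X.card - Y.card := by
      have := card_le_card hY'
      omega
    exact (h.insert haE hat ha1 ha2 hU).exists_spanning hE hmin hp hR hY'
termination_by X.card - Y.card

/-- A set `F` of link arcs, with endpoints `g` in `X`, is completed to a branching in `X`. -/
theorem exists_branching_of_cover {ι : Type*} {X : Finset V} {E : Finset (V × V)}
    {w : V × V → ℤ} {𝒴 : Multiset (Finset V)} (hE : ∀ a ∈ E, a.1 ∈ X ∧ a.2 ∈ X)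
    (hmin : IsCostMinimal X E w 𝒴) (hp : IsPacking X E w 𝒴) (F : Finset ι) (g : ι → V)
    (hg : ∀ i ∈ F, g i ∈ X)
    (hcap : ∀ U ∈ 𝒴, ∀ i ∈ F, ∀ j ∈ F, g i ∈ U → g j ∈ U → i = j)
    (hcov : ∀ K, IsMinTightClosed X E w 𝒴 K → ∃ i ∈ F, g i ∈ K) :
    ∃ B, IsBranching E B ∧ (X.filter fun v => ∀ a ∈ B, a.2 ≠ v) = F.image g ∧
      (∑ i ∈ F, (depth 𝒴 (g i) : ℤ)) + ∑ a ∈ B, w a ≤ 𝒴.card := by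
  have hcard : ∀ U ∈ 𝒴, (F.image g ∩ U).card ≤ 1 := by
    intro U hU
    rw [card_le_one]
    simp only [mem_inter, mem_image]
    rintro _ ⟨⟨i, hi, rfl⟩, hiU⟩ _ ⟨⟨j, hj, rfl⟩, hjU⟩
    rw [hcap U hU i hi j hj hiU hjU]
  have hsub : F.image g ⊆ X := by
    intro v hv
    obtain ⟨i, hi, rfl⟩ := mem_image.1 hv
    exact hg i hi
  have h0 : IsPartialBranching E w 𝒴 (F.image g) (F.image g) ∅ :=
    ⟨subset_rfl, by simp, by simp, by simp, fun v hv hv' => absurd hv hv', by simp,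
      fun ⟨n, f, hf⟩ => by simpa using hf 0, by simp, by simpa using hcard⟩
  obtain ⟨B, hB⟩ := h0.exists_spanning hE hmin hp (fun K hK => by
    obtain ⟨K', hK'K, hK'⟩ := hK.exists_min
    obtain ⟨i, hi, hiK⟩ := hcov K' hK'
    exact ⟨g i, mem_image_of_mem g hi, hK'K hiK⟩) hsub
  refine ⟨B, ⟨hB.subset, fun v => ?_, hB.acyclic⟩, ?_, ?_⟩
  · rw [card_le_one]
    simp only [mem_filter]
    rintro a ⟨ha, rfl⟩ b ⟨hb, hb'⟩
    exact hB.unique a ha b hb hb'.symm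
  · ext v
    rw [mem_filter]
    constructor
    · rintro ⟨hv, hv'⟩
      by_contra hcon
      obtain ⟨a, ha, ha'⟩ := hB.exists_arc v hv hcon
      exact hv' a ha ha'
    · exact fun hv => ⟨hsub hv, fun a ha h => hB.head_notMem a ha (h ▸ hv)⟩
  · rw [← sum_congr rfl hB.tight]
    norm_cast
    rw [sum_depth, sum_cutLoad, ← Multiset.sum_map_add]
    refine Multiset.sum_map_le_card _ _ fun U hU => le_trans ?_ (hB.once U hU)
    refine Nat.add_le_add_right ?_ _
    have h1 : (F.filter fun i => g i ∈ U).card ≤ 1 := by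
      rw [card_le_one]
      simp only [mem_filter]
      rintro i ⟨hi, hiU⟩ j ⟨hj, hjU⟩
      exact hcap U hU i hi j hj hiU hjU
    rcases (F.filter fun i => g i ∈ U).eq_empty_or_nonempty with h | ⟨i, hi⟩
    · simp [h]
    · rw [mem_filter] at hi
      exact h1.trans (card_pos.2 ⟨g i, mem_inter.2 ⟨mem_image_of_mem g hi.1, hi.2⟩⟩)

theorem depth_ne_zero_iff {𝒴 : Multiset (Finset V)} {v : V} :
    depth 𝒴 v ≠ 0 ↔ ∃ U ∈ 𝒴, v ∈ U := by
  rw [← Nat.pos_iff_ne_zero, depth, Multiset.countP_pos]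

theorem IsLaminar.exists_largest {𝒴 : Multiset (Finset V)} (h : IsLaminar 𝒴) {v : V}
    (hv : depth 𝒴 v ≠ 0) : ∃ U ∈ 𝒴, v ∈ U ∧ ∀ W ∈ 𝒴, v ∈ W → W ⊆ U := by
  obtain ⟨U₀, hU₀, hv₀⟩ := depth_ne_zero_iff.1 hv
  obtain ⟨U, hU, hmax⟩ := exists_max_image (𝒴.toFinset.filter (v ∈ ·)) Finset.card
    ⟨U₀, by simp [hU₀, hv₀]⟩
  simp only [mem_filter, Multiset.mem_toFinset] at hU hmax
  refine ⟨U, hU.1, hU.2, fun W hW hvW => ?_⟩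
  rcases h W hW U hU.1 with h | h | h
  · exact h
  · exact (eq_of_subset_of_card_le h (hmax W ⟨hW, hvW⟩)).ge
  · exact absurd hU.2 (disjoint_left.1 h hvW)

theorem cutLoad_val (J : Finset (Finset V)) (a : V × V) :
    cutLoad J.val a = (J.filter fun U => Enters U a).card := by
  rw [cutLoad, Multiset.countP_eq_card_filter]
  rfl

theorem depth_val (J : Finset (Finset V)) (v : V) :
    depth J.val v = (J.filter fun U => v ∈ U).card := by
  rw [depth, Multiset.countP_eq_card_filter]
  rfl

/-- A pair of packings, on two vertex sets joined by the link arcs `L` with endpoints `g`, `h`. -/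
structure IsDualPair {ι : Type*} (X Y : Finset V) (E E' : Finset (V × V)) (w w' : V × V → ℤ)
    (L : Finset ι) (c : ι → ℤ) (g h : ι → V) (𝒴 𝒵 : Multiset (Finset V)) : Prop where
  left : IsPacking X E w 𝒴
  right : IsPacking Y E' w' 𝒵
  link : ∀ a ∈ L, (depth 𝒴 (g a) : ℤ) + depth 𝒵 (h a) ≤ c a

/-- Increasing `𝒴` along disjoint tightly closed sets and decreasing `𝒵`. -/
theorem IsDualPair.shift {ι : Type*} {X Y : Finset V} {E E' : Finset (V × V)}
    {w w' : V × V → ℤ} {L : Finset ι} {c : ι → ℤ} {g h : ι → V} {𝒴 𝒵 : Multiset (Finset V)}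
    (hd : IsDualPair X Y E E' w w' L c g h 𝒴 𝒵) {J N : Finset (Finset V)}
    (hJ : ∀ K ∈ J, IsMinTightClosed X E w 𝒴 K) (hN : ∀ U ∈ N, U ∈ 𝒵)
    (hJN : ∀ a ∈ L, (depth 𝒴 (g a) : ℤ) + depth 𝒵 (h a) = c a →
      ∀ K ∈ J, g a ∈ K → ∃ U ∈ N, h a ∈ U) :
    IsDualPair X Y E E' w w' L c g h (J.val + 𝒴) (𝒵 - N.val) := by
  have hNle : N.val ≤ 𝒵 := Finset.val_le_iff_val_subset.2 fun U hU => hN U hU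
  have hJcard : ∀ v, (J.filter fun U => v ∈ U).card ≤ 1 := by
    intro v
    rw [card_le_one]
    simp only [mem_filter]
    exact fun K hK K' hK' => (hJ K hK.1).eq_of_mem (hJ K' hK'.1) hK.2 hK'.2
  refine ⟨⟨fun U hU => ?_, fun a ha => ?_⟩, ⟨fun U hU => ?_, fun a ha => ?_⟩, fun a ha => ?_⟩
  · rcases Multiset.mem_add.1 hU with hU | hU
    · exact ⟨(hJ U hU).1.1, (hJ U hU).1.2.1⟩
    · exact hd.left.1 U hU
  · have h0 := hd.left.2 a ha
    have h1 : cutLoad (J.val + 𝒴) a = (J.filter fun U => Enters U a).card + cutLoad 𝒴 a := by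
      rw [← cutLoad_val, cutLoad, Multiset.countP_add]; rfl
    have h2 : (J.filter fun U => Enters U a).card ≤ 1 :=
      (card_le_card (monotone_filter_right J fun U _ hU => hU.1)).trans (hJcard a.2)
    rcases h0.lt_or_eq with h0 | h0
    · omega
    · have : J.filter (fun U => Enters U a) = ∅ := by
        rw [filter_eq_empty_iff]
        exact fun K hK hKa => hKa.2 ((hJ K hK).1.2.2.2 a ha h0 hKa.1)
      rw [h1, this]
      simpa using h0.le
  · exact hd.right.1 U (Multiset.mem_of_le (Multiset.sub_le_self _ _) hU)
  · refine le_trans ?_ (hd.right.2 a ha)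
    exact_mod_cast Multiset.countP_le_of_le _ (Multiset.sub_le_self _ _)
  · have h0 := hd.link a ha
    have h1 : depth (J.val + 𝒴) (g a) = (J.filter fun U => g a ∈ U).card + depth 𝒴 (g a) := by
      rw [← depth_val, depth, Multiset.countP_add]; rfl
    have h2 : depth (𝒵 - N.val) (h a) = depth 𝒵 (h a) - (N.filter fun U => h a ∈ U).card := by
      rw [← depth_val, depth, Multiset.countP_sub hNle]; rfl
    have h3 := hJcard (g a)
    have h5 : (N.filter fun U => h a ∈ U).card ≤ depth 𝒵 (h a) := by
      rw [← depth_val]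
      exact Multiset.countP_le_of_le _ hNle
    by_cases hex : ∃ K ∈ J, g a ∈ K
    · rcases h0.lt_or_eq with h0 | h0
      · omega
      · obtain ⟨K, hK, hKa⟩ := hex
        obtain ⟨U, hU, hUa⟩ := hJN a ha h0 K hK hKa
        have h4 : 0 < (N.filter fun U => h a ∈ U).card := card_pos.2 ⟨U, by simp [hU, hUa]⟩
        omega
    · have : J.filter (fun U => g a ∈ U) = ∅ := by
        rw [filter_eq_empty_iff]
        exact fun K hK hKa => hex ⟨K, hK, hKa⟩
      rw [this, card_empty] at h1
      omega

/-- No two distinct elements of `F` have their images under `g` in a common member of `𝒴`. -/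
def IsCapped {ι : Type*} (g : ι → V) (𝒴 : Multiset (Finset V)) (F : Finset ι) : Prop :=
  ∀ U ∈ 𝒴, ∀ a ∈ F, ∀ b ∈ F, g a ∈ U → g b ∈ U → a = b

theorem IsDualPair.exists_oneSided_cover {ι : Type*} {X Y : Finset V} {E E' : Finset (V × V)}
    {w w' : V × V → ℤ} {L : Finset ι} {c : ι → ℤ} {g h : ι → V} {𝒴 𝒵 : Multiset (Finset V)}
    (hd : IsDualPair X Y E E' w w' L c g h 𝒴 𝒵)
    (hmax : ∀ 𝒴' 𝒵', IsDualPair X Y E E' w w' L c g h 𝒴' 𝒵' →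
      𝒴'.card + 𝒵'.card ≤ 𝒴.card + 𝒵.card)
    (hlam : IsLaminar 𝒵) :
    ∃ F ⊆ L.filter (fun a => (depth 𝒴 (g a) : ℤ) + depth 𝒵 (h a) = c a),
      IsCapped g 𝒴 F ∧ IsCapped h 𝒵 F ∧ ∀ K, IsMinTightClosed X E w 𝒴 K → ∃ a ∈ F, g a ∈ K := by
  set T := L.filter (fun a => (depth 𝒴 (g a) : ℤ) + depth 𝒵 (h a) = c a) with hT
  have hblob : ∀ v, ∃ U, depth 𝒵 v ≠ 0 → U ∈ 𝒵 ∧ v ∈ U ∧ ∀ W ∈ 𝒵, v ∈ W → W ⊆ U := by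
    intro v
    by_cases hv : depth 𝒵 v = 0
    · exact ⟨∅, fun h => absurd hv h⟩
    · obtain ⟨U, hU⟩ := hlam.exists_largest hv
      exact ⟨U, fun _ => hU⟩
  choose blob hblob using hblob
  let κ := {K : Finset V // IsMinTightClosed X E w 𝒴 K ∧ ∀ a ∈ T, g a ∈ K → depth 𝒵 (h a) ≠ 0}
  let t : κ → Finset (Finset V) := fun K => (T.filter fun a => g a ∈ K.1).image fun a => blob (h a)
  have hall : ∀ J : Finset κ, J.card ≤ (J.biUnion t).card := by
    intro J
    have hd' := hd.shift (J := J.map (Function.Embedding.subtype _)) (N := J.biUnion t) ?_ ?_ ?_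
    · have h1 := hmax _ _ hd'
      rw [Multiset.card_add] at h1
      have h2 : 𝒵.card ≤ (𝒵 - (J.biUnion t).val).card + (J.biUnion t).val.card := by
        rw [← Multiset.card_add]
        exact Multiset.card_le_card le_tsub_add
      simp only [card_val, card_map] at h1 h2
      omega
    · intro K hK
      obtain ⟨K, -, rfl⟩ := mem_map.1 hK
      exact K.2.1
    · intro U hU
      simp only [t, mem_biUnion, mem_image, mem_filter] at hU
      obtain ⟨K, -, a, ⟨ha, haK⟩, rfl⟩ := hU
      exact (hblob _ (K.2.2 a ha haK)).1
    · intro a ha hat K hK hKa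
      obtain ⟨K, hKJ, rfl⟩ := mem_map.1 hK
      have haT : a ∈ T := mem_filter.2 ⟨ha, hat⟩
      exact ⟨blob (h a), mem_biUnion.2 ⟨K, hKJ, mem_image_of_mem _ (mem_filter.2 ⟨haT, hKa⟩)⟩,
        (hblob _ (K.2.2 a haT hKa)).2.1⟩
  obtain ⟨f, hf, hft⟩ := (all_card_le_biUnion_card_iff_exists_injective t).1 hall
  have hchoice : ∀ K : {K : Finset V // IsMinTightClosed X E w 𝒴 K}, ∃ a ∈ T, g a ∈ K.1 ∧
      (depth 𝒵 (h a) ≠ 0 → ∃ hK, f ⟨K.1, hK⟩ = blob (h a)) := by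
    rintro ⟨K, hK⟩
    by_cases hfree : ∀ a ∈ T, g a ∈ K → depth 𝒵 (h a) ≠ 0
    · have := hft ⟨K, hK, hfree⟩
      simp only [t, mem_image, mem_filter] at this
      obtain ⟨a, ⟨ha, haK⟩, hfa⟩ := this
      exact ⟨a, ha, haK, fun _ => ⟨⟨hK, hfree⟩, hfa.symm⟩⟩
    · push Not at hfree
      obtain ⟨a, ha, haK, h0⟩ := hfree
      exact ⟨a, ha, haK, fun h => absurd h0 h⟩
  choose arc harcT harcK harcf using hchoice
  refine ⟨univ.image arc, ?_, ?_, ?_, fun K hK => ⟨arc ⟨K, hK⟩, by simp, harcK ⟨K, hK⟩⟩⟩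
  · intro a ha
    obtain ⟨K, -, rfl⟩ := mem_image.1 ha
    exact harcT K
  · intro U hU a ha b hb haU hbU
    obtain ⟨K, -, rfl⟩ := mem_image.1 ha
    obtain ⟨K', -, rfl⟩ := mem_image.1 hb
    have : K.1 = K'.1 :=
      K.2.eq_of_mem K'.2 (K.2.subset_of_mem hU (harcK K) haU hbU) (harcK K')
    rw [Subtype.ext this]
  · intro U hU a ha b hb haU hbU
    obtain ⟨K, -, rfl⟩ := mem_image.1 ha
    obtain ⟨K', -, rfl⟩ := mem_image.1 hb
    have hn := depth_ne_zero_iff.2 ⟨U, hU, haU⟩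
    have hn' := depth_ne_zero_iff.2 ⟨U, hU, hbU⟩
    obtain ⟨hK, hfK⟩ := harcf K hn
    obtain ⟨hK', hfK'⟩ := harcf K' hn'
    obtain ⟨hb1, hb2, hb3⟩ := hblob _ hn
    obtain ⟨hb1', hb2', hb3'⟩ := hblob _ hn'
    have heq : blob (h (arc K)) = blob (h (arc K')) := by
      refine subset_antisymm (hb3' _ hb1 (hb3 U hU haU hbU)) (hb3 _ hb1' (hb3' U hU hbU haU))
    rw [← hfK, ← hfK'] at heq
    have : K.1 = K'.1 := congrArg (fun K : κ => K.1) (hf heq)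
    rw [Subtype.ext this]

theorem IsCapped.swap {ι : Type*} [DecidableEq ι] {g : ι → V} {𝒴 : Multiset (Finset V)}
    {F : Finset ι} (hlam : IsLaminar 𝒴) (hF : IsCapped g 𝒴 F) {a b : ι} (hb : b ∈ F)
    {U : Finset V} (hU : U ∈ 𝒴) (haU : g a ∈ U) (hbU : g b ∈ U) :
    IsCapped g 𝒴 (insert a (F.erase b)) := by
  have key : ∀ W ∈ 𝒴, g a ∈ W → ∀ x ∈ F.erase b, g x ∉ W := by
    intro W hW haW x hx hxW
    rw [mem_erase] at hx
    rcases hlam U hU W hW with h | h | h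
    · exact hx.1 (hF W hW x hx.2 b hb hxW (h hbU))
    · exact hx.1 (hF U hU x hx.2 b hb (h hxW) hbU)
    · exact disjoint_left.1 h haU haW
  intro W hW x hx y hy hxW hyW
  rcases mem_insert.1 hx with rfl | hx' <;> rcases mem_insert.1 hy with rfl | hy'
  · rfl
  · exact absurd hyW (key W hW hxW y hy')
  · exact absurd hxW (key W hW hyW x hx')
  · exact hF W hW x (mem_of_mem_erase hx') y (mem_of_mem_erase hy') hxW hyW

theorem IsCapped.mono {ι : Type*} {g : ι → V} {𝒴 : Multiset (Finset V)} {F F' : Finset ι}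
    (hF : IsCapped g 𝒴 F) (h : F' ⊆ F) : IsCapped g 𝒴 F' :=
  fun U hU a ha b hb => hF U hU a (h ha) b (h hb)

theorem IsCapped.insert {ι : Type*} [DecidableEq ι] {g : ι → V} {𝒴 : Multiset (Finset V)}
    {F : Finset ι} (hF : IsCapped g 𝒴 F) {a : ι}
    (ha : ∀ U ∈ 𝒴, g a ∈ U → ∀ x ∈ F, g x ∉ U) : IsCapped g 𝒴 (insert a F) := by
  intro W hW x hx y hy hxW hyW
  rcases mem_insert.1 hx with rfl | hx' <;> rcases mem_insert.1 hy with rfl | hy'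
  · rfl
  · exact absurd hyW (ha W hW hxW y hy')
  · exact absurd hxW (ha W hW hyW x hx')
  · exact hF W hW x hx' y hy' hxW hyW

/-- Covers of the two sides are merged into a cover of both sides. -/
theorem exists_twoSided_cover {ι : Type*} {X Y : Finset V} {E E' : Finset (V × V)}
    {w w' : V × V → ℤ} {T : Finset ι} {g h : ι → V} {𝒴 𝒵 : Multiset (Finset V)}
    (hlam : IsLaminar 𝒵) {F₁ F₂ : Finset ι}
    (hF₁ : F₁ ⊆ T) (hcap₁ : IsCapped h 𝒵 F₁)
    (hcov₁ : ∀ K, IsMinTightClosed X E w 𝒴 K → ∃ a ∈ F₁, g a ∈ K)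
    (hF₂ : F₂ ⊆ T) (hcap₂ : IsCapped g 𝒴 F₂) (hcap₂' : IsCapped h 𝒵 F₂)
    (hcov₂ : ∀ K, IsMinTightClosed Y E' w' 𝒵 K → ∃ a ∈ F₂, h a ∈ K) :
    ∃ F ⊆ T, IsCapped g 𝒴 F ∧ IsCapped h 𝒵 F ∧
      (∀ K, IsMinTightClosed X E w 𝒴 K → ∃ a ∈ F, g a ∈ K) ∧
      ∀ K, IsMinTightClosed Y E' w' 𝒵 K → ∃ a ∈ F, h a ∈ K := by
  let C : Finset ι → Finset (Finset V) := fun F =>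
    univ.filter fun K => IsMinTightClosed X E w 𝒴 K ∧ ∃ a ∈ F, g a ∈ K
  have hC : ∀ F K, K ∈ C F ↔ IsMinTightClosed X E w 𝒴 K ∧ ∃ a ∈ F, g a ∈ K := by
    simp [C]
  obtain ⟨F, hF, hmax⟩ := exists_max_image
    (T.powerset.filter fun F => IsCapped g 𝒴 F ∧ IsCapped h 𝒵 F ∧
      ∀ K, IsMinTightClosed Y E' w' 𝒵 K → ∃ a ∈ F, h a ∈ K)
    (fun F => (C F).card * (F₁.card + 1) + (F ∩ F₁).card)
    ⟨F₂, by simp only [mem_filter, mem_powerset]; exact ⟨hF₂, hcap₂, hcap₂', hcov₂⟩⟩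
  simp only [mem_filter, mem_powerset] at hF hmax
  obtain ⟨hFT, hcg, hch, hcovF⟩ := hF
  refine ⟨F, hFT, hcg, hch, ?_, hcovF⟩
  by_contra! hcon
  obtain ⟨K, hK, hKF⟩ := hcon
  obtain ⟨a, ha, haK⟩ := hcov₁ K hK
  have haF : a ∉ F := fun h => hKF a h haK
  have hcga : IsCapped g 𝒴 (insert a F) := hcg.insert fun U hU haU x hx hxU =>
    hKF x hx (hK.subset_of_mem hU haK haU hxU)
  have hKC : K ∉ C F := fun hKC => by
    obtain ⟨x, hx, hx'⟩ := ((hC F K).1 hKC).2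
    exact hKF x hx hx'
  have hle : ∀ F' : Finset ι, (F' ∩ F₁).card ≤ F₁.card := fun F' => card_le_card inter_subset_right
  by_cases hconf : ∃ U ∈ 𝒵, h a ∈ U ∧ ∃ b ∈ F, h b ∈ U
  · obtain ⟨U, hU, haU, b, hb, hbU⟩ := hconf
    have hbF₁ : b ∉ F₁ := fun hb₁ => haF (hcap₁ U hU a ha b hb₁ haU hbU ▸ hb)
    have h1 := hmax (insert a (F.erase b)) ⟨insert_subset (hF₁ ha) ((erase_subset _ _).trans hFT),
      hcga.mono (insert_subset_insert _ (erase_subset _ _)), hch.swap hlam hb hU haU hbU, ?_⟩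
    · have h2 : (insert a (F.erase b) ∩ F₁).card = (F ∩ F₁).card + 1 := by
        rw [insert_inter_of_mem ha, erase_inter, erase_eq_of_notMem (by simp [hbF₁]),
          card_insert_of_notMem (by simp [haF])]
      have h3 : ((C F).filter fun K' => g b ∈ K').card ≤ 1 := by
        rw [card_le_one]
        simp only [mem_filter, hC]
        exact fun K₁ h₁ K₂ h₂ => h₁.1.1.eq_of_mem h₂.1.1 h₁.2 h₂.2
      have h4 : insert K ((C F).filter fun K' => g b ∉ K') ⊆ C (insert a (F.erase b)) := by
        intro K' hK'
        rw [hC]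
        rcases mem_insert.1 hK' with rfl | hK'
        · exact ⟨hK, a, mem_insert_self _ _, haK⟩
        · rw [mem_filter, hC] at hK'
          obtain ⟨⟨hm, x, hx, hxK'⟩, hbK'⟩ := hK'
          refine ⟨hm, x, mem_insert_of_mem (mem_erase.2 ⟨?_, hx⟩), hxK'⟩
          rintro rfl
          exact hbK' hxK'
      have h5 := card_le_card h4
      rw [card_insert_of_notMem (by simp [hKC])] at h5
      have h6 := card_filter_add_card_filter_not (s := C F) (fun K' => g b ∈ K')
      have h7 : (C F).card ≤ (C (insert a (F.erase b))).card := by omega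
      have h8 := Nat.mul_le_mul_right (F₁.card + 1) h7
      omega
    · intro K' hK'
      obtain ⟨x, hx, hxK'⟩ := hcovF K' hK'
      by_cases hxb : x = b
      · subst hxb
        exact ⟨a, mem_insert_self _ _, hK'.subset_of_mem hU hxK' hbU haU⟩
      · exact ⟨x, mem_insert_of_mem (mem_erase.2 ⟨hxb, hx⟩), hxK'⟩
  · push Not at hconf
    have h1 := hmax (insert a F) ⟨insert_subset (hF₁ ha) hFT, hcga,
      hch.insert fun U hU haU x hx => hconf U hU haU x hx, fun K' hK' => by
        obtain ⟨x, hx, hxK'⟩ := hcovF K' hK'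
        exact ⟨x, mem_insert_of_mem hx, hxK'⟩⟩
    have h4 : insert K (C F) ⊆ C (insert a F) := by
      intro K' hK'
      rw [hC]
      rcases mem_insert.1 hK' with rfl | hK'
      · exact ⟨hK, a, mem_insert_self _ _, haK⟩
      · obtain ⟨hm, x, hx, hxK'⟩ := (hC F K').1 hK'
        exact ⟨hm, x, mem_insert_of_mem hx, hxK'⟩
    have h5 := card_le_card h4
    rw [card_insert_of_notMem hKC] at h5
    have h8 := Nat.mul_le_mul_right (F₁.card + 1) h5
    have h9 := hle F
    rw [Nat.add_mul] at h8
    omega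

theorem hasCycle_of_forall_exists {B : Finset (V × V)} {U : Finset V} (hU : U.Nonempty)
    (h : ∀ v ∈ U, ∃ u ∈ U, (u, v) ∈ B) : HasCycle B := by
  have h' : ∀ v : U, ∃ u : U, (u.1, v.1) ∈ B := fun v => by
    obtain ⟨u, hu, huv⟩ := h v.1 v.2
    exact ⟨⟨u, hu⟩, huv⟩
  choose f hf using h'
  obtain ⟨x, hx⟩ := hU
  obtain ⟨m, n, hmn, heq⟩ : ∃ m n, m < n ∧ f^[m] ⟨x, hx⟩ = f^[n] ⟨x, hx⟩ := by
    obtain ⟨m, n, hne, heq⟩ := Finite.exists_ne_map_eq_of_infinite fun n => f^[n] ⟨x, hx⟩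
    rcases hne.lt_or_gt with hlt | hlt
    · exact ⟨m, n, hlt, heq⟩
    · exact ⟨n, m, hlt, heq.symm⟩
  obtain ⟨k, rfl⟩ := Nat.exists_eq_add_of_lt hmn
  obtain ⟨y, hper⟩ : ∃ y, f^[k + 1] y = y :=
    ⟨f^[m] ⟨x, hx⟩, by rw [← Function.iterate_add_apply, heq, show k + 1 + m = m + k + 1 by omega]⟩
  refine ⟨k, fun i => (f^[k - i.1] y).1, fun i => ?_⟩
  have hstep : f (f^[k - (i + 1).1] y) = f^[k - i.1] y := by
    rw [← Function.iterate_succ_apply' f]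
    rcases Fin.eq_castSucc_or_eq_last i with ⟨j, rfl⟩ | rfl
    · have := j.2
      rw [Fin.coeSucc_eq_succ]
      simp only [Fin.val_succ, Fin.val_castSucc]
      congr 2
      omega
    · simpa using hper
  have := hf (f^[k - (i + 1).1] y)
  rwa [hstep] at this

theorem IsBranching.one_le_card {E B : Finset (V × V)} (hB : IsBranching E B) {X U : Finset V}
    (hUX : U ⊆ X) (hU : U.Nonempty) :
    1 ≤ ((X.filter fun v => ∀ a ∈ B, a.2 ≠ v) ∩ U).card + (B.filter (Enters U)).card := by
  by_contra! hcon
  obtain ⟨h1, h2⟩ : ((X.filter fun v => ∀ a ∈ B, a.2 ≠ v) ∩ U) = ∅ ∧ B.filter (Enters U) = ∅ := by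
    rw [← card_eq_zero, ← card_eq_zero]
    omega
  refine hB.2.2 (hasCycle_of_forall_exists hU fun v hv => ?_)
  have hv' : v ∉ X.filter fun v => ∀ a ∈ B, a.2 ≠ v := fun hv' =>
    notMem_empty v (h1 ▸ mem_inter.2 ⟨hv', hv⟩)
  rw [mem_filter] at hv'
  push Not at hv'
  obtain ⟨a, ha, rfl⟩ := hv' (hUX hv)
  refine ⟨a.1, ?_, ha⟩
  by_contra hcon
  exact filter_eq_empty_iff.1 h2 ha ⟨hv, hcon⟩

theorem IsPacking.card_le {X : Finset V} {E B : Finset (V × V)} {w : V × V → ℤ}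
    {𝒴 : Multiset (Finset V)} (hp : IsPacking X E w 𝒴) (hB : IsBranching E B) {η : V → ℤ}
    (hη : ∀ v ∈ X, 0 ≤ η v)
    (hR : (X.filter fun v => ∀ a ∈ B, a.2 ≠ v) = X.filter fun v => 0 < η v) :
    (𝒴.card : ℤ) ≤ ∑ a ∈ B, w a + ∑ v ∈ X, (depth 𝒴 v : ℤ) * η v := by
  have h1 : 𝒴.card ≤ ∑ v ∈ X.filter (fun v => 0 < η v), depth 𝒴 v + ∑ a ∈ B, cutLoad 𝒴 a := by
    rw [sum_depth _ fun v => v, sum_cutLoad, ← Multiset.sum_map_add]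
    refine Multiset.card_le_sum_map _ _ fun U hU => ?_
    have := hB.one_le_card (hp.1 U hU).1 (hp.1 U hU).2
    rwa [hR, ← filter_mem_eq_inter] at this
  have h2 : ∑ v ∈ X.filter (fun v => 0 < η v), (depth 𝒴 v : ℤ) ≤
      ∑ v ∈ X, (depth 𝒴 v : ℤ) * η v := by
    rw [sum_filter]
    refine sum_le_sum fun v hv => ?_
    split_ifs with h
    · exact le_mul_of_one_le_right (by positivity) h
    · exact mul_nonneg (by positivity) (hη v hv)
  have h3 : ∑ a ∈ B, (cutLoad 𝒴 a : ℤ) ≤ ∑ a ∈ B, w a :=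
    sum_le_sum fun a ha => hp.2 a (hB.1 ha)
  zify at h1
  linarith

theorem le_inf_add {α : Type*} {s : Finset α} {f : α → ℤ} {m c : ℤ} (h : ∀ a ∈ s, m ≤ f a + c) :
    (m : WithTop ℤ) ≤ s.inf (fun a => (f a : WithTop ℤ)) + c := by
  rcases s.eq_empty_or_nonempty with rfl | hs
  · simp
  · obtain ⟨a, ha, h'⟩ := exists_mem_eq_inf s hs fun a => (f a : WithTop ℤ)
    rw [h']
    exact_mod_cast h a ha

theorem IsPacking.card_le_gT {T : Finset V} {A : Finset (V × V)} {w : V × V → ℤ}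
    {𝒴 : Multiset (Finset V)} (hp : IsPacking T (arcsIn T A) w 𝒴) (η : V → ℤ) :
    ((𝒴.card : ℤ) : WithTop ℤ) ≤
      gT T A w η + ((∑ v ∈ T, (depth 𝒴 v : ℤ) * η v : ℤ) : WithTop ℤ) := by
  unfold gT
  split_ifs with hη
  · refine le_inf_add fun B hB => ?_
    rw [mem_filter] at hB
    exact hp.card_le hB.2.1 hη hB.2.2
  · simp

theorem sum_image_swap (B : Finset (V × V)) (w : V × V → ℤ) :
    ∑ a ∈ B.image Prod.swap, w a.swap = ∑ a ∈ B, w a := by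
  rw [sum_image Prod.swap_injective.injOn]
  simp

theorem IsPacking.card_le_gS {S : Finset V} {A : Finset (V × V)} {w : V × V → ℤ}
    {𝒵 : Multiset (Finset V)}
    (hp : IsPacking S ((arcsIn S A).image Prod.swap) (fun a => w a.swap) 𝒵) (η : V → ℤ) :
    ((𝒵.card : ℤ) : WithTop ℤ) ≤
      gS S A w η + ((∑ v ∈ S, (depth 𝒵 v : ℤ) * η v : ℤ) : WithTop ℤ) := by
  unfold gS
  split_ifs with hη
  · refine le_inf_add fun B hB => ?_
    rw [mem_filter] at hB
    have := hp.card_le hB.2.1 hη (by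
      rw [← hB.2.2]
      simp only [forall_mem_image, Prod.snd_swap])
    rwa [sum_image_swap] at this
  · simp

theorem gT_le {T : Finset V} {A B : Finset (V × V)} {w : V × V → ℤ} {η : V → ℤ}
    (hη : ∀ v, 0 ≤ η v) (hB : IsBranching (arcsIn T A) B)
    (hR : (T.filter fun v => ∀ a ∈ B, a.2 ≠ v) = T.filter fun v => 0 < η v) :
    gT T A w η ≤ ((∑ a ∈ B, w a : ℤ) : WithTop ℤ) := by
  rw [gT, if_pos fun v _ => hη v]
  exact inf_le (mem_filter.2 ⟨mem_powerset.2 hB.1, hB, hR⟩)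

theorem gS_le {S : Finset V} {A B : Finset (V × V)} {w : V × V → ℤ} {η : V → ℤ}
    (hη : ∀ v, 0 ≤ η v) (hB : IsBranching ((arcsIn S A).image Prod.swap) B)
    (hR : (S.filter fun v => ∀ a ∈ B, a.2 ≠ v) = S.filter fun v => 0 < η v) :
    gS S A w η ≤ ((∑ a ∈ B, w a.swap : ℤ) : WithTop ℤ) := by
  have hsw : (B.image Prod.swap).image Prod.swap = B := by
    simp [image_image]
  rw [gS, if_pos fun v _ => hη v, ← hsw, sum_image_swap]
  refine inf_le (f := fun B => ((∑ a ∈ B, w a : ℤ) : WithTop ℤ))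
    (mem_filter.2 ⟨mem_powerset.2 ?_, ?_, ?_⟩)
  · intro a ha
    obtain ⟨b, hb, rfl⟩ := mem_image.1 ha
    obtain ⟨c, hc, rfl⟩ := mem_image.1 (hB.1 hb)
    simpa using hc
  · rwa [IsCobranching, hsw]
  · rw [← hR]
    simp only [forall_mem_image, Prod.fst_swap]

theorem exists_forall_le_of_nat {α : Type*} {P : α → Prop} (f : α → ℕ) (h : ∃ x, P x) :
    ∃ x, P x ∧ ∀ y, P y → f x ≤ f y := by
  obtain ⟨x, hx⟩ := h
  obtain ⟨y, hy, hmin⟩ := (measure f).wf.has_min {x | P x} ⟨x, hx⟩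
  exact ⟨y, hy, fun z hz => not_lt.1 (hmin z hz)⟩

theorem IsDualPair.symm {ι : Type*} {X Y : Finset V} {E E' : Finset (V × V)}
    {w w' : V × V → ℤ} {L : Finset ι} {c : ι → ℤ} {g h : ι → V} {𝒴 𝒵 : Multiset (Finset V)}
    (hd : IsDualPair X Y E E' w w' L c g h 𝒴 𝒵) : IsDualPair Y X E' E w' w L c h g 𝒵 𝒴 :=
  ⟨hd.right, hd.left, fun a ha => by rw [add_comm]; exact hd.link a ha⟩

theorem exists_optimal_dualPair {ι : Type*} {X Y : Finset V} {E E' : Finset (V × V)}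
    {w w' : V × V → ℤ} {L : Finset ι} {c : ι → ℤ} {g h : ι → V}
    (h0 : IsDualPair X Y E E' w w' L c g h 0 0) (M : ℕ)
    (hM : ∀ 𝒴 𝒵, IsDualPair X Y E E' w w' L c g h 𝒴 𝒵 → 𝒴.card + 𝒵.card ≤ M) :
    ∃ 𝒴 𝒵, IsDualPair X Y E E' w w' L c g h 𝒴 𝒵 ∧
      (∀ 𝒴' 𝒵', IsDualPair X Y E E' w w' L c g h 𝒴' 𝒵' →
        𝒴'.card + 𝒵'.card ≤ 𝒴.card + 𝒵.card) ∧
      IsCostMinimal X E w 𝒴 ∧ IsCostMinimal Y E' w' 𝒵 := by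
  let P : Multiset (Finset V) × Multiset (Finset V) → Prop := fun y =>
    IsDualPair X Y E E' w w' L c g h y.1 y.2
  obtain ⟨x, hx, hxmax⟩ := exists_forall_le_of_nat (P := P)
    (fun y => M - (y.1.card + y.2.card)) ⟨(0, 0), h0⟩
  obtain ⟨y, ⟨hy, hyx⟩, hymin⟩ := exists_forall_le_of_nat
    (P := fun y => P y ∧ y.1.card + y.2.card = x.1.card + x.2.card)
    (fun y => familyCost y.1 + familyCost y.2) ⟨x, hx, rfl⟩
  have hxM := hM _ _ hx
  refine ⟨y.1, y.2, hy, fun 𝒴' 𝒵' h' => ?_, fun 𝒴' hp hc hdep => ?_, fun 𝒵' hp hc hdep => ?_⟩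
  · have h1 : M - (x.1.card + x.2.card) ≤ M - (𝒴'.card + 𝒵'.card) := hxmax (𝒴', 𝒵') h'
    have h2 := hM _ _ h'
    omega
  · have := hymin (𝒴', y.2) ⟨⟨hp, hy.right, fun a ha => ?_⟩, by simp only [hc, hyx]⟩
    · simpa using this
    · have h1 := hy.link a ha
      have h2 := hdep (g a)
      dsimp only
      omega
  · have := hymin (y.1, 𝒵') ⟨⟨hy.left, hp, fun a ha => ?_⟩, by simp only [hc, hyx]⟩
    · simpa using this
    · have h1 := hy.link a ha
      have h2 := hdep (h a)
      dsimp only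
      omega

theorem sum_comp_eq_sum_mul_card {ι : Type*} {X : Finset V} (F : Finset ι) (g : ι → V)
    (hg : ∀ a ∈ F, g a ∈ X) (d : V → ℤ) :
    ∑ a ∈ F, d (g a) = ∑ v ∈ X, d v * ((F.filter fun a => g a = v).card : ℤ) := by
  rw [← sum_fiberwise_of_maps_to hg]
  refine sum_congr rfl fun v _ => ?_
  rw [sum_congr rfl fun a ha => congrArg d (mem_filter.1 ha).2, sum_const, nsmul_eq_mul, mul_comm]

theorem image_eq_filter_card_pos {ι : Type*} {X : Finset V} (F : Finset ι) (g : ι → V)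
    (hg : ∀ a ∈ F, g a ∈ X) :
    F.image g = X.filter fun v => 0 < ((F.filter fun a => g a = v).card : ℤ) := by
  ext v
  simp only [mem_image, mem_filter, Nat.cast_pos, card_pos, filter_nonempty_iff]
  constructor
  · rintro ⟨a, ha, rfl⟩
    exact ⟨hg a ha, a, ha, rfl⟩
  · exact fun h => h.2

/-- Packings of cuts of `D[T]` and of the reversal of `D[S]`, jointly feasible on `A[S,T]`. -/
def IsBibranchingDual (S T : Finset V) (A : Finset (V × V)) (w : V × V → ℤ)
    (𝒴 𝒵 : Multiset (Finset V)) : Prop :=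
  IsDualPair T S (arcsIn T A) ((arcsIn S A).image Prod.swap) w (fun a => w a.swap)
    (arcsST S T A) w Prod.snd Prod.fst 𝒴 𝒵

theorem IsBibranchingDual.sum_le {S T : Finset V} {A F : Finset (V × V)} {w : V × V → ℤ}
    {𝒴 𝒵 : Multiset (Finset V)} (hd : IsBibranchingDual S T A w 𝒴 𝒵) (hF : F ⊆ arcsST S T A) :
    ∑ a ∈ F, (w a - depth 𝒴 a.2 - depth 𝒵 a.1) = ∑ a ∈ F, w a
      - ∑ v ∈ T, (depth 𝒴 v : ℤ) * ind F v - ∑ u ∈ S, (depth 𝒵 u : ℤ) * outd F u ∧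
    ∀ a ∈ F, 0 ≤ w a - depth 𝒴 a.2 - depth 𝒵 a.1 := by
  refine ⟨?_, fun a ha => by have := hd.link a (hF ha); omega⟩
  have h1 := sum_comp_eq_sum_mul_card (X := T) F Prod.snd
    (fun a ha => (mem_filter.1 (hF ha)).2.2) fun v => (depth 𝒴 v : ℤ)
  have h2 := sum_comp_eq_sum_mul_card (X := S) F Prod.fst
    (fun a ha => (mem_filter.1 (hF ha)).2.1) fun v => (depth 𝒵 v : ℤ)
  rw [sum_sub_distrib, sum_sub_distrib, h1, h2]
  rfl

/-- Strong duality for shortest bibranchings. -/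
theorem exists_bibranchingDual_msfObj_le (S T : Finset V) (A : Finset (V × V)) (w : V × V → ℤ)
    (hw : ∀ a ∈ A, 0 ≤ w a) (F : Finset (V × V)) (hF : F ⊆ arcsST S T A)
    (hfeas : msfObj S T A w F ≠ ⊤) :
    ∃ 𝒴 𝒵, IsBibranchingDual S T A w 𝒴 𝒵 ∧
      ∃ F' ⊆ arcsST S T A, msfObj S T A w F' ≤ ((𝒴.card + 𝒵.card : ℤ) : WithTop ℤ) := by
  obtain ⟨hs, ht⟩ : gS S A w (outd F) ≠ ⊤ ∧ gT T A w (ind F) ≠ ⊤ := by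
    simpa [msfObj] using hfeas
  obtain ⟨s, hs⟩ := WithTop.ne_top_iff_exists.1 hs
  obtain ⟨t, ht⟩ := WithTop.ne_top_iff_exists.1 ht
  obtain ⟨𝒴, 𝒵, hd, hmax, hmin, hmin'⟩ :=
    exists_optimal_dualPair (X := T) (Y := S) (E := arcsIn T A)
      (E' := (arcsIn S A).image Prod.swap) (w := w) (w' := fun a => w a.swap)
      (L := arcsST S T A) (c := w) (g := Prod.snd) (h := Prod.fst)
      ⟨⟨by simp, fun a ha => by simpa [cutLoad] using hw a (mem_filter.1 ha).1⟩,
        ⟨by simp, fun a ha => by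
          obtain ⟨b, hb, rfl⟩ := mem_image.1 ha
          simpa [cutLoad] using hw b (mem_filter.1 hb).1⟩,
        fun a ha => by simpa [depth] using hw a (mem_filter.1 ha).1⟩
      (∑ a ∈ F, w a + s + t).toNat fun 𝒴 𝒵 hd => by
        have h1 := hd.left.card_le_gT (ind F)
        have h2 := hd.right.card_le_gS (outd F)
        obtain ⟨h3, h4⟩ := IsBibranchingDual.sum_le hd hF
        have h5 := sum_nonneg h4
        rw [← ht] at h1
        rw [← hs] at h2
        norm_cast at h1 h2
        omega
  have hlam := hmin.isLaminar hd.left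
  have hlam' := hmin'.isLaminar hd.right
  obtain ⟨F₁, hF₁, -, hcap₁, hcov₁⟩ := hd.exists_oneSided_cover hmax hlam'
  obtain ⟨F₂, hF₂, hcap₂', hcap₂, hcov₂⟩ := hd.symm.exists_oneSided_cover
    (fun 𝒵' 𝒴' h => by have := hmax 𝒴' 𝒵' h.symm; omega) hlam
  simp only [add_comm (depth 𝒵 _ : ℤ)] at hF₂
  obtain ⟨F', hF', hcap, hcap', hcov, hcov'⟩ :=
    exists_twoSided_cover hlam' hF₁ hcap₁ hcov₁ hF₂ hcap₂ hcap₂' hcov₂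
  have hFL : ∀ a ∈ F', a ∈ arcsST S T A := fun a ha => (mem_filter.1 (hF' ha)).1
  have hsnd : ∀ a ∈ F', a.2 ∈ T := fun a ha => (mem_filter.1 (hFL a ha)).2.2
  have hfst : ∀ a ∈ F', a.1 ∈ S := fun a ha => (mem_filter.1 (hFL a ha)).2.1
  obtain ⟨B, hB, hBR, hBw⟩ := exists_branching_of_cover
    (fun a ha => (mem_filter.1 ha).2) hmin hd.left F' Prod.snd hsnd hcap hcov
  obtain ⟨B', hB', hBR', hBw'⟩ := exists_branching_of_cover
    (fun a ha => by
      obtain ⟨b, hb, rfl⟩ := mem_image.1 ha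
      exact (mem_filter.1 hb).2.symm) hmin' hd.right F' Prod.fst hfst hcap' hcov'
  refine ⟨𝒴, 𝒵, hd, F', hFL, ?_⟩
  have hT := gT_le (w := w) (η := ind F') (fun v => by simp [ind]) hB
    (hBR.trans (image_eq_filter_card_pos F' Prod.snd hsnd))
  have hS := gS_le (w := w) (η := outd F') (fun v => by simp [outd]) hB'
    (hBR'.trans (image_eq_filter_card_pos F' Prod.fst hfst))
  refine (add_le_add (add_le_add le_rfl hS) hT).trans ?_
  have htight : ∑ a ∈ F', ((depth 𝒴 a.2 : ℤ) + depth 𝒵 a.1) = ∑ a ∈ F', w a :=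
    sum_congr rfl fun a ha => (mem_filter.1 (hF' ha)).2
  rw [sum_add_distrib] at htight
  norm_cast
  push_cast
  linarith

/-- An optimal flow for (MSF) admits an optimal potential `(p, q)` which is
tight (`w(a) + p(u) − q(v) = 0`) on every arc carrying flow. -/
theorem exists_tight_optimal_potential
    (S T : Finset V) (hdisj : Disjoint S T) (hu : S ∪ T = Finset.univ)
    (hS : S.Nonempty) (hT : T.Nonempty)
    (A : Finset (V × V)) (hA : ∀ a ∈ A, ¬ (a.1 ∈ T ∧ a.2 ∈ S))
    (w : V × V → ℤ) (hw : ∀ a ∈ A, 0 ≤ w a)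
    (F : Finset (V × V)) (hF : F ⊆ arcsST S T A)
    (hfeas : msfObj S T A w F ≠ ⊤)
    (hopt : ∀ F' ⊆ arcsST S T A, msfObj S T A w F ≤ msfObj S T A w F') :
    ∃ p q : V → ℤ,
      (∀ a ∈ arcsST S T A,
        (a ∈ F → w a + p a.1 - q a.2 = 0) ∧ (a ∉ F → 0 ≤ w a + p a.1 - q a.2)) ∧
      (∀ η : V → ℤ,
        gS S A w (outd F) + ((∑ u ∈ S, -p u * outd F u : ℤ) : WithTop ℤ)
          ≤ gS S A w η + ((∑ u ∈ S, -p u * η u : ℤ) : WithTop ℤ)) ∧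
      (∀ η : V → ℤ,
        gT T A w (ind F) + ((∑ v ∈ T, q v * ind F v : ℤ) : WithTop ℤ)
          ≤ gT T A w η + ((∑ v ∈ T, q v * η v : ℤ) : WithTop ℤ)) := by
  obtain ⟨𝒴, 𝒵, hd, F', hF', hle⟩ := exists_bibranchingDual_msfObj_le S T A w hw F hF hfeas
  have hle := (hopt F' hF').trans hle
  obtain ⟨hs, ht⟩ : gS S A w (outd F) ≠ ⊤ ∧ gT T A w (ind F) ≠ ⊤ := by
    simpa [msfObj] using hfeas
  obtain ⟨s, hs⟩ := WithTop.ne_top_iff_exists.1 hs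
  obtain ⟨t, ht⟩ := WithTop.ne_top_iff_exists.1 ht
  have h1 := hd.left.card_le_gT (ind F)
  have h2 := hd.right.card_le_gS (outd F)
  obtain ⟨h3, h4⟩ := hd.sum_le hF
  have h5 := sum_nonneg h4
  rw [msfObj, ← hs, ← ht] at hle
  rw [← ht] at h1
  rw [← hs] at h2
  norm_cast at h1 h2 hle
  push_cast at hle
  refine ⟨fun u => -depth 𝒵 u, fun v => depth 𝒴 v, fun a ha => ⟨fun haF => ?_, fun _ => ?_⟩,
    fun η => ?_, fun η => ?_⟩
  · have := (sum_eq_zero_iff_of_nonneg h4).1 (by omega) a haF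
    dsimp only
    omega
  · have := hd.link a ha
    dsimp only
    omega
  · simp only [neg_neg]
    refine le_trans ?_ (hd.right.card_le_gS η)
    rw [← hs]
    norm_cast
    omega
  · refine le_trans ?_ (hd.left.card_le_gT η)
    rw [← ht]
    norm_cast
    dsimp only
    omega
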